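/- arXiv:1707.00401 — 12 statements merged into one kernel-verified Lean document; each statement's English description precedes it below -/
import Mathlib

section
/- Reciprocity Theorem for Laplacian spectra of simple digraphs: Let D be a simple digraph on n ≥ 1 vertices with adjacency matrix A : Matrix (Fin n) (Fin n) ℝ (every entry 0 or 1, zero diagonal). Let L = R − A be its Laplacian matrix, where R is the diagonal matrix of row sums of A, and let L^c = R^c − (J − I − A) be the Laplacian matrix of the complement D^c, where R^c is the diagonal matrix of row sums of J − I − A. Then for every λ ∈ ℝ: (n − λ) · det(λ·I − L^c) = (−1)^(n−1) · λ · det((n − λ)·I − L). -/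
open Matrix

theorem aux_rank_one (n : ℕ) (hn : 1 ≤ n) (M J : Matrix (Fin n) (Fin n) ℝ) (μ : ℝ)
    (hJ : ∀ i j, J i j = 1) (hM : ∀ i, ∑ j, M i j = μ) :
    μ * (M - J).det = (μ - n) * M.det := by
  by_cases hμ : μ = 0
  · have : M.det = 0 := by
      apply Matrix.exists_mulVec_eq_zero_iff.mp
      refine ⟨fun _ => 1, ?_, ?_⟩
      · intro h
        have := congrFun h ⟨0, hn⟩
        simp at this
      · ext i
        simp [Matrix.mulVec, dotProduct, hM, hμ]
    rw [this, hμ]; simp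
  · have h1 : M - J = M * (1 + Matrix.replicateCol Unit (fun _ : Fin n => -μ⁻¹)
        * Matrix.replicateRow Unit (fun _ : Fin n => (1 : ℝ))) := by
      rw [Matrix.mul_add, Matrix.mul_one]
      ext i j
      rw [← Matrix.mul_assoc]
      simp only [Matrix.sub_apply, Matrix.add_apply, Matrix.mul_apply, Matrix.replicateCol_apply,
        Matrix.replicateRow_apply, hJ, ← Finset.sum_mul, hM]
      simp [hμ, sub_eq_add_neg]
    rw [h1, Matrix.det_mul, Matrix.det_one_add_replicateCol_mul_replicateRow]
    simp only [dotProduct, Finset.sum_const, Finset.card_univ, Fintype.card_fin, nsmul_eq_mul]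
    field_simp
    ring

/-- Reciprocity Theorem for Laplacian spectra of simple digraphs. -/
theorem laplacian_reciprocity (n : ℕ) (hn : 1 ≤ n)
    (A J L Lc : Matrix (Fin n) (Fin n) ℝ)
    (hA01 : ∀ i j, A i j = 0 ∨ A i j = 1)
    (hAdiag : ∀ i, A i i = 0)
    (hJ : ∀ i j, J i j = 1)
    (hL : L = Matrix.diagonal (fun i => ∑ j, A i j) - A)
    (hLc : Lc = Matrix.diagonal (fun i => ∑ j, (J - 1 - A) i j) - (J - 1 - A))
    (lam : ℝ) :
    ((n : ℝ) - lam) * (lam • (1 : Matrix (Fin n) (Fin n) ℝ) - Lc).det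
      = (-1 : ℝ) ^ (n - 1) * lam *
        (((n : ℝ) - lam) • (1 : Matrix (Fin n) (Fin n) ℝ) - L).det := by
  have key := aux_rank_one n hn (((n : ℝ) - lam) • (1 : Matrix (Fin n) (Fin n) ℝ) - L) J
    ((n : ℝ) - lam) hJ (by
      intro i
      simp [hL, Matrix.one_apply, Matrix.diagonal_apply, Finset.sum_sub_distrib])
  have e : lam • (1 : Matrix (Fin n) (Fin n) ℝ) - Lc
      = -((((n : ℝ) - lam) • (1 : Matrix (Fin n) (Fin n) ℝ) - L) - J) := by
    ext i j
    by_cases h : i = j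
    · subst h
      simp [hL, hLc, hJ, hAdiag, Matrix.one_apply, Finset.sum_sub_distrib]
      ring
    · simp [hL, hLc, hJ, Matrix.one_apply, Matrix.diagonal_apply, h]
      try ring
  rw [e, Matrix.det_neg, Fintype.card_fin]
  obtain ⟨k, rfl⟩ : ∃ k, n = k + 1 := ⟨n - 1, by omega⟩
  rw [Nat.add_sub_cancel, pow_succ]
  linear_combination (-(-1 : ℝ) ^ k) * key
end

section
/- Adjacency reciprocity for out-regular digraphs with loops: Let A : Matrix (Fin n) (Fin n) ℝ have every entry 0 or 1 (diagonal entries may be 1, i.e. loops are allowed, but there are no multiple arcs) and every row sum of A equal to r (every vertex has out-degree r). Then for every λ ∈ ℝ: (λ + r) · det(λ·I − (J − A)) = (−1)^n · (λ − n + r) · det(−λ·I − A). Equivalently, A(λ, D_∘^c) = (−1)^n (λ − n + r)(λ + r)^{−1} A(−λ, D), where D_∘^c is the K_∘-complement of D. -/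
open Matrix

/-- Adjacency reciprocity for out-regular digraphs with loops allowed. -/
theorem adjacency_reciprocity_loops (n : ℕ) (r : ℝ)
    (A J : Matrix (Fin n) (Fin n) ℝ)
    (hA01 : ∀ i j, A i j = 0 ∨ A i j = 1)
    (hJ : ∀ i j, J i j = 1)
    (hreg : ∀ i, ∑ j, A i j = r)
    (lam : ℝ) :
    (lam + r) * (lam • (1 : Matrix (Fin n) (Fin n) ℝ) - (J - A)).det
      = (-1 : ℝ) ^ n * (lam - n + r) *
        ((-lam) • (1 : Matrix (Fin n) (Fin n) ℝ) - A).det := by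
  obtain ⟨M, hM⟩ : ∃ M, M = lam • (1 : Matrix (Fin n) (Fin n) ℝ) + A := ⟨_, rfl⟩
  have h1 : (-lam) • (1 : Matrix (Fin n) (Fin n) ℝ) - A = -M := by
    rw [hM, neg_smul]; abel
  have h2 : lam • (1 : Matrix (Fin n) (Fin n) ℝ) - (J - A) = M - J := by
    rw [hM]; abel
  have hrow : ∀ i, ∑ j, M i j = lam + r := by
    intro i
    simp [hM, Matrix.one_apply, Finset.sum_add_distrib, hreg]
  have hsq : (-1 : ℝ) ^ n * (-1 : ℝ) ^ n = 1 := by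
    rw [← mul_pow]; simp
  rw [h1, h2, det_neg, Fintype.card_fin]
  suffices h : (lam + r) * (M - J).det = (lam - n + r) * M.det by
    rw [h]; linear_combination (-(lam - n + r) * M.det) * hsq
  by_cases hs : lam + r = 0
  · rcases Nat.eq_zero_or_pos n with rfl | hn
    · simp
    · have : M.det = 0 := by
        rw [← Matrix.exists_mulVec_eq_zero_iff]
        refine ⟨fun _ => 1, fun h => one_ne_zero (congrFun h ⟨0, hn⟩), ?_⟩
        ext i
        simp [mulVec, dotProduct, hrow, hs]
      rw [hs, this]; simp
  · have h3 : M - J = M * (1 + replicateCol Unit (fun _ => (1:ℝ)) *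
        replicateRow Unit (fun _ => -(lam + r)⁻¹)) := by
      ext i j
      simp only [Matrix.mul_add, Matrix.mul_one, Matrix.sub_apply, Matrix.add_apply, hJ]
      simp only [Matrix.mul_apply, replicateCol_apply, replicateRow_apply,
        Finset.univ_unique, Finset.sum_singleton, one_mul]
      rw [← Finset.sum_mul, hrow]
      field_simp
      ring
    rw [h3, det_mul, det_one_add_replicateCol_mul_replicateRow]
    simp only [dotProduct, mul_one, Finset.sum_const, Finset.card_univ, Fintype.card_fin,
      nsmul_eq_mul]
    field_simp
    ring
end

section
/- Eigenvalues of polynomial expressions in A and J for regular matrices: Let A : Matrix (Fin n) (Fin n) ℝ satisfy A * 𝟙 = r • 𝟙 and 𝟙ᵀ * A = r • 𝟙ᵀ for some r ∈ ℝ (every row sum and every column sum of A equals r), where 𝟙 is the all-ones column vector. Then for every real polynomial g, every c ∈ ℝ, and every λ ∈ ℝ: (λ − g(r)) · det(λ·I − (g(A) + c·J)) = (λ − g(r) − c·n) · det(λ·I − g(A)), where g(A) is the evaluation of the polynomial g at the matrix A. (This expresses that any polynomial f(A, J) in A and J, which necessarily has the form g(A) + c·J, has eigenvalues f(r, n) together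 with f(α_i, 0) for the remaining n−1 eigenvalues α_i of A.) -/
open Matrix Polynomial

/-- Eigenvalues of polynomial expressions in `A` and `J` for regular matrices. -/
theorem eigen_poly_in_A_and_J (n : ℕ) (r : ℝ)
    (A J : Matrix (Fin n) (Fin n) ℝ)
    (hJ : ∀ i j, J i j = 1)
    (hrow : A.mulVec (fun _ => 1) = fun _ => r)
    (hcol : Matrix.vecMul (fun _ => 1) A = fun _ => r)
    (g : Polynomial ℝ) (c lam : ℝ) :
    (lam - g.eval r) *
        (lam • (1 : Matrix (Fin n) (Fin n) ℝ) - (Polynomial.aeval A g + c • J)).det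
      = (lam - g.eval r - c * n) *
        (lam • (1 : Matrix (Fin n) (Fin n) ℝ) - Polynomial.aeval A g).det := by
  have hAJ : A * J = r • J := by
    ext i j
    have := congrFun hrow i
    simp only [Matrix.mulVec, dotProduct, mul_one] at this
    simp only [Matrix.mul_apply, hJ, Matrix.smul_apply, smul_eq_mul, this, mul_one]
  have hg : Polynomial.aeval A g * J = g.eval r • J := by
    induction g using Polynomial.induction_on' with
    | add p q hp hq => rw [map_add, add_mul, hp, hq, Polynomial.eval_add, add_smul]
    | monomial k a =>
      have hk : ∀ k : ℕ, A ^ k * J = r ^ k • J := by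
        intro k
        induction k with
        | zero => simp
        | succ k ih => rw [pow_succ, mul_assoc, hAJ, mul_smul_comm, ih, smul_smul, pow_succ, mul_comm]
      rw [Polynomial.aeval_monomial, Polynomial.eval_monomial, mul_assoc, hk,
        ← Algebra.smul_def, smul_smul]
  obtain ⟨μ, hμ⟩ : ∃ μ, μ = lam - g.eval r := ⟨_, rfl⟩
  obtain ⟨M, hM⟩ : ∃ M, M = lam • (1 : Matrix (Fin n) (Fin n) ℝ) - Polynomial.aeval A g := ⟨_, rfl⟩
  have hMJ : M * J = μ • J := by
    rw [hM, hμ, sub_mul, hg, smul_mul_assoc, one_mul, sub_smul]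
  rw [← sub_sub, ← hM, ← hμ]
  by_cases h0 : μ = 0
  · rcases Nat.eq_zero_or_pos n with hn | hn
    · subst hn
      simp
    · have hd : M.det = 0 := by
        apply Matrix.exists_mulVec_eq_zero_iff.mp
        refine ⟨fun _ => 1, fun h => one_ne_zero (congrFun h ⟨0, hn⟩), ?_⟩
        ext i
        have := congrFun (congrFun hMJ i) ⟨0, hn⟩
        simpa [Matrix.mul_apply, hJ, h0, Matrix.mulVec, dotProduct] using this
      rw [h0, hd]; simp
  · have hf : M - c • J = M * (1 + replicateCol Unit (fun _ => -(c / μ)) * replicateRow Unit (fun _ => (1 : ℝ))) := by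
      have : replicateCol Unit (fun _ : Fin n => -(c / μ)) * replicateRow Unit (fun _ : Fin n => (1 : ℝ)) = (-(c / μ)) • J := by
        ext i j
        simp [Matrix.mul_apply, hJ]
      rw [this, mul_add, mul_one, mul_smul_comm, hMJ, smul_smul, neg_mul, div_mul_cancel₀ _ h0,
        neg_smul, sub_eq_add_neg]
    rw [hf, Matrix.det_mul, Matrix.det_one_add_replicateCol_mul_replicateRow]
    simp [dotProduct]
    field_simp
    try ring
end

section
/- Spectrum of D^{+01}: Let D be an r-regular digraph (loops and multiple arcs allowed) on n ≥ 1 vertices with adjacency matrix A : Matrix (Fin n) (Fin n) ℝ (nonnegative integer entries, all row and column sums equal to r ≥ 1) and m = n·r arcs. Let M = fromBlocks A J_{n,m} J_{m,n} 0 (the adjacency matrix of the transformation D^{+01}, which keeps the arcs of D among the vertices, has no arcs among the arc-vertices, and has all arcs between the two parts in both directions). Then for every λ ∈ ℝ: (λ − r) · det(λ·I_{n+m} − M) = λ^{m−1} · (λ² − r·λ − m·n) · det(λ·I_n − A). -/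
open Matrix

lemma aux_det {n : ℕ} (B : Matrix (Fin n) (Fin n) ℝ) (s c : ℝ) (hs : s ≠ 0)
    (hB : ∀ i, ∑ j, B i j = s) :
    s * (B - c • Matrix.of (fun _ _ => (1:ℝ))).det = (s - c * n) * B.det := by
  have h : B - c • Matrix.of (fun _ _ => (1:ℝ)) =
      B * (1 + replicateCol Unit (fun _ => -(c / s)) * replicateRow Unit (fun _ => (1:ℝ))) := by
    rw [mul_add, mul_one, sub_eq_add_neg]
    congr 1
    ext i j
    simp only [mul_apply, replicateCol_apply, replicateRow_apply, Finset.univ_unique,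
      Finset.sum_const, Finset.card_singleton, one_smul, mul_one, ← Finset.sum_mul, hB,
      Matrix.neg_apply, Matrix.smul_apply, of_apply, smul_eq_mul]
    field_simp
  rw [h, det_mul, det_one_add_replicateCol_mul_replicateRow]
  simp [dotProduct]
  field_simp
  ring

/-- Spectrum of the transformation `D^{+01}` of an `r`-regular general digraph. -/
theorem spectrum_plus_zero_one (n r m : ℕ) (hn : 1 ≤ n) (hr : 1 ≤ r) (hm : m = n * r)
    (A : Matrix (Fin n) (Fin n) ℝ)
    (hAnat : ∀ i j, ∃ k : ℕ, A i j = (k : ℝ))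
    (hrow : ∀ i, ∑ j, A i j = (r : ℝ))
    (hcol : ∀ j, ∑ i, A i j = (r : ℝ))
    (Jnm : Matrix (Fin n) (Fin m) ℝ) (hJnm : ∀ i e, Jnm i e = 1)
    (Jmn : Matrix (Fin m) (Fin n) ℝ) (hJmn : ∀ e i, Jmn e i = 1)
    (lam : ℝ) :
    (lam - (r : ℝ)) *
        (lam • (1 : Matrix (Fin n ⊕ Fin m) (Fin n ⊕ Fin m) ℝ)
          - Matrix.fromBlocks A Jnm Jmn 0).det
      = lam ^ (m - 1) * (lam ^ 2 - (r : ℝ) * lam - (m : ℝ) * (n : ℝ)) *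
        (lam • (1 : Matrix (Fin n) (Fin n) ℝ) - A).det := by
  have hm1 : 1 ≤ m := by rw [hm]; exact Nat.mul_pos hn hr
  have hd : Dense (({0, (r:ℝ)} : Set ℝ)ᶜ) :=
    Set.Countable.dense_compl ℝ (Set.toFinite _).countable
  refine congrFun (Continuous.ext_on hd
    (f := fun lam : ℝ => (lam - (r : ℝ)) *
        (lam • (1 : Matrix (Fin n ⊕ Fin m) (Fin n ⊕ Fin m) ℝ)
          - Matrix.fromBlocks A Jnm Jmn 0).det)
    (g := fun lam : ℝ => lam ^ (m - 1) * (lam ^ 2 - (r : ℝ) * lam - (m : ℝ) * (n : ℝ)) *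
        (lam • (1 : Matrix (Fin n) (Fin n) ℝ) - A).det) ?_ ?_ ?_) lam
  · refine Continuous.mul (by fun_prop) (Continuous.matrix_det (by fun_prop))
  · refine Continuous.mul (by fun_prop) (Continuous.matrix_det (by fun_prop))
  intro x hx
  simp only [Set.mem_compl_iff, Set.mem_insert_iff, Set.mem_singleton_iff, not_or] at hx
  obtain ⟨h0, h1⟩ := hx
  have hs : x - r ≠ 0 := sub_ne_zero.mpr h1
  have hB : ∀ i, ∑ j, (x • (1 : Matrix (Fin n) (Fin n) ℝ) - A) i j = x - r := by
    intro i
    simp [Finset.sum_sub_distrib, hrow, one_apply]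
  have key := aux_det _ (x - r) (m / x) hs hB
  have hblk : x • (1 : Matrix (Fin n ⊕ Fin m) (Fin n ⊕ Fin m) ℝ)
      - Matrix.fromBlocks A Jnm Jmn 0 =
      fromBlocks (x • 1 - A) (-Jnm) (-Jmn) (x • 1) := by
    rw [← fromBlocks_one, fromBlocks_smul, sub_eq_add_neg, fromBlocks_neg, fromBlocks_add]
    simp [sub_eq_add_neg]
  letI : Invertible (x • (1 : Matrix (Fin m) (Fin m) ℝ)) :=
    ⟨x⁻¹ • 1, by simp [smul_smul, h0], by simp [smul_smul, h0]⟩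
  have hinv : ⅟(x • (1 : Matrix (Fin m) (Fin m) ℝ)) = x⁻¹ • 1 := rfl
  have hJ : (-Jnm) * ⅟(x • (1 : Matrix (Fin m) (Fin m) ℝ)) * (-Jmn) =
      ((m:ℝ) / x) • Matrix.of (fun _ _ => (1:ℝ)) := by
    rw [hinv]
    ext i j
    simp [mul_apply, hJnm, hJmn]
    field_simp
  show (x - (r : ℝ)) * _ = _
  rw [hblk, det_fromBlocks₂₂, hJ, mul_left_comm, key, det_smul, det_one, Fintype.card_fin]
  obtain ⟨k, rfl⟩ : ∃ k, m = k + 1 := ⟨m - 1, by omega⟩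
  simp only [Nat.add_sub_cancel, pow_succ]
  field_simp
end

section
/- Spectrum of D^{0+1}: Let D be an r-regular digraph (loops and multiple arcs allowed) with n ≥ 1 vertices and m = n·r arcs (r ≥ 1), encoded by incidence matrices T, H : Matrix (Fin n) (Fin m) ℝ. Let M = fromBlocks 0 J_{n,m} J_{m,n} (Hᵀ * T) (the adjacency matrix of the transformation D^{0+1}, which has no arcs among the vertices, the line-digraph arcs among the arc-vertices, and all arcs between the two parts in both directions). Then for every λ ∈ ℝ: (λ − r) · det(λ·I_{n+m} − M) = λ^{m−1} · (λ² − r·λ − m·n) · det(λ·I_n − T * Hᵀ). -/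
open Matrix

theorem aux_rank_one_s6 (m : ℕ) (x : ℝ) :
    ((1 : Matrix (Fin m) (Fin m) ℝ) - x • Matrix.of (fun _ _ => (1 : ℝ))).det = 1 - x * m := by
  have h : x • (Matrix.of (fun _ _ => (1 : ℝ)) : Matrix (Fin m) (Fin m) ℝ)
      = (Matrix.of (fun _ _ => x) : Matrix (Fin m) (Fin 1) ℝ)
        * (Matrix.of (fun _ _ => 1) : Matrix (Fin 1) (Fin m) ℝ) := by
    ext i j
    simp [Matrix.mul_apply]
  rw [h, Matrix.det_one_sub_mul_comm]
  simp [Matrix.mul_apply, mul_comm]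

theorem aux_line (n m : ℕ) (T H : Matrix (Fin n) (Fin m) ℝ) (lam : ℝ) (h0 : lam ≠ 0) :
    lam ^ n * (lam • (1 : Matrix (Fin m) (Fin m) ℝ) - Hᵀ * T).det
      = lam ^ m * (lam • (1 : Matrix (Fin n) (Fin n) ℝ) - T * Hᵀ).det := by
  have e1 : lam • (1 : Matrix (Fin m) (Fin m) ℝ) - Hᵀ * T
      = lam • (1 - (lam⁻¹ • Hᵀ) * T) := by
    rw [smul_sub, Matrix.smul_mul, smul_smul, mul_inv_cancel₀ h0, one_smul]
  have e2 : lam • (1 : Matrix (Fin n) (Fin n) ℝ) - T * Hᵀ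
      = lam • (1 - T * (lam⁻¹ • Hᵀ)) := by
    rw [smul_sub, Matrix.mul_smul, smul_smul, mul_inv_cancel₀ h0, one_smul]
  rw [e1, e2, Matrix.det_smul, Matrix.det_smul, Matrix.det_one_sub_mul_comm]
  simp only [Fintype.card_fin]
  ring

theorem aux_generic (n r m : ℕ) (hn : 1 ≤ n) (hr : 1 ≤ r) (hm : m = n * r)
    (T H : Matrix (Fin n) (Fin m) ℝ)
    (hTcol : ∀ e, ∑ i, T i e = 1)
    (hHcol : ∀ e, ∑ i, H i e = 1)
    (hTrow : ∀ i, ∑ e, T i e = (r : ℝ))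
    (hHrow : ∀ i, ∑ e, H i e = (r : ℝ))
    (Jnm : Matrix (Fin n) (Fin m) ℝ) (hJnm : ∀ i e, Jnm i e = 1)
    (Jmn : Matrix (Fin m) (Fin n) ℝ) (hJmn : ∀ e i, Jmn e i = 1)
    (lam : ℝ) (h0 : lam ≠ 0) (hsub : lam - (r : ℝ) ≠ 0) :
    (lam - (r : ℝ)) *
        (lam • (1 : Matrix (Fin n ⊕ Fin m) (Fin n ⊕ Fin m) ℝ)
          - Matrix.fromBlocks 0 Jnm Jmn (Hᵀ * T)).det
      = lam ^ (m - 1) * (lam ^ 2 - (r : ℝ) * lam - (m : ℝ) * (n : ℝ)) *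
        (lam • (1 : Matrix (Fin n) (Fin n) ℝ) - T * Hᵀ).det := by
  set J : Matrix (Fin m) (Fin m) ℝ := Matrix.of (fun _ _ => (1 : ℝ)) with hJ
  have hm1 : m = (m - 1) + 1 := by
    have : 0 < m := by rw [hm]; positivity
    omega
  have hJB : J * (Hᵀ * T) = (r : ℝ) • J := by
    rw [← Matrix.mul_assoc]
    ext i j
    simp only [Matrix.mul_apply, hJ, Matrix.of_apply, Matrix.transpose_apply, one_mul, hHrow,
      Matrix.smul_apply, smul_eq_mul, mul_one]
    rw [← Finset.mul_sum, hTcol, mul_one]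
  have hblk : lam • (1 : Matrix (Fin n ⊕ Fin m) (Fin n ⊕ Fin m) ℝ)
          - Matrix.fromBlocks 0 Jnm Jmn (Hᵀ * T)
      = Matrix.fromBlocks (lam • 1) (-Jnm) (-Jmn) (lam • 1 - Hᵀ * T) := by
    rw [← Matrix.fromBlocks_one, Matrix.fromBlocks_smul, sub_eq_add_neg, Matrix.fromBlocks_neg,
      Matrix.fromBlocks_add]
    simp [sub_eq_add_neg]
  letI : Invertible (lam • (1 : Matrix (Fin n) (Fin n) ℝ)) :=
    ⟨lam⁻¹ • 1, by simp [smul_smul, h0], by simp [smul_smul, h0]⟩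
  have hinv : ⅟(lam • (1 : Matrix (Fin n) (Fin n) ℝ)) = lam⁻¹ • 1 := rfl
  have hJJ : (-Jmn) * (lam⁻¹ • (1 : Matrix (Fin n) (Fin n) ℝ)) * (-Jnm)
      = (lam⁻¹ * n) • J := by
    ext i j
    simp [Matrix.mul_apply, hJnm, hJmn, hJ, mul_comm]
  have hfac : lam • (1 : Matrix (Fin m) (Fin m) ℝ) - Hᵀ * T - (lam⁻¹ * n) • J
      = (1 - (lam⁻¹ * n / (lam - r)) • J) * (lam • 1 - Hᵀ * T) := by
    rw [Matrix.sub_mul, Matrix.one_mul, Matrix.smul_mul, Matrix.mul_sub, hJB, Matrix.mul_smul,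
      Matrix.mul_one, ← sub_smul, smul_smul, div_mul_cancel₀ _ hsub]
  rw [hblk, Matrix.det_fromBlocks₁₁, hinv, hJJ, hfac, Matrix.det_mul, aux_rank_one_s6,
    Matrix.det_smul, Matrix.det_one, Fintype.card_fin]
  have hl := aux_line n m T H lam h0
  have hp : lam ^ m = lam ^ (m - 1) * lam := by rw [← pow_succ, ← hm1]
  rw [hp] at hl
  calc _ = ((lam - r) * (1 - lam⁻¹ * n / (lam - r) * m))
        * (lam ^ n * (lam • (1 : Matrix (Fin m) (Fin m) ℝ) - Hᵀ * T).det) := by ring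
    _ = _ := by
      rw [hl]
      have : (lam - r) * (1 - lam⁻¹ * n / (lam - r) * m) * lam
          = lam ^ 2 - r * lam - m * n := by
        field_simp
      rw [← this]
      ring

/-- Spectrum of the transformation `D^{0+1}` of an `r`-regular general digraph. -/
theorem spectrum_zero_plus_one (n r m : ℕ) (hn : 1 ≤ n) (hr : 1 ≤ r) (hm : m = n * r)
    (T H : Matrix (Fin n) (Fin m) ℝ)
    (hT01 : ∀ i e, T i e = 0 ∨ T i e = 1)
    (hH01 : ∀ i e, H i e = 0 ∨ H i e = 1)
    (hTcol : ∀ e, ∑ i, T i e = 1)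
    (hHcol : ∀ e, ∑ i, H i e = 1)
    (hTrow : ∀ i, ∑ e, T i e = (r : ℝ))
    (hHrow : ∀ i, ∑ e, H i e = (r : ℝ))
    (Jnm : Matrix (Fin n) (Fin m) ℝ) (hJnm : ∀ i e, Jnm i e = 1)
    (Jmn : Matrix (Fin m) (Fin n) ℝ) (hJmn : ∀ e i, Jmn e i = 1)
    (lam : ℝ) :
    (lam - (r : ℝ)) *
        (lam • (1 : Matrix (Fin n ⊕ Fin m) (Fin n ⊕ Fin m) ℝ)
          - Matrix.fromBlocks 0 Jnm Jmn (Hᵀ * T)).det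
      = lam ^ (m - 1) * (lam ^ 2 - (r : ℝ) * lam - (m : ℝ) * (n : ℝ)) *
        (lam • (1 : Matrix (Fin n) (Fin n) ℝ) - T * Hᵀ).det := by
  revert lam
  have hd : Dense (({0, (r : ℝ)} : Set ℝ)ᶜ) :=
    Set.Countable.dense_compl ℝ (Set.Finite.countable (Set.toFinite _))
  have hc1 : Continuous fun lam : ℝ => (lam - (r : ℝ)) *
        (lam • (1 : Matrix (Fin n ⊕ Fin m) (Fin n ⊕ Fin m) ℝ)
          - Matrix.fromBlocks 0 Jnm Jmn (Hᵀ * T)).det := by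
    refine Continuous.mul (by fun_prop) (Continuous.matrix_det ?_)
    fun_prop
  have hc2 : Continuous fun lam : ℝ =>
      lam ^ (m - 1) * (lam ^ 2 - (r : ℝ) * lam - (m : ℝ) * (n : ℝ)) *
        (lam • (1 : Matrix (Fin n) (Fin n) ℝ) - T * Hᵀ).det := by
    refine Continuous.mul (by fun_prop) (Continuous.matrix_det ?_)
    fun_prop
  refine fun lam => congrFun (Continuous.ext_on hd hc1 hc2 ?_) lam
  intro lam hlam
  simp only [Set.mem_compl_iff, Set.mem_insert_iff, Set.mem_singleton_iff, not_or] at hlam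
  obtain ⟨h0, hr0⟩ := hlam
  have hsub : lam - (r : ℝ) ≠ 0 := sub_ne_zero.mpr hr0
  exact aux_generic n r m hn hr hm T H hTcol hHcol hTrow hHrow Jnm hJnm Jmn hJmn lam h0 hsub
end

section
/- Spectrum of D^{++1}: Let D be an r-regular digraph (loops and multiple arcs allowed) with n ≥ 1 vertices and m = n·r arcs (r ≥ 1), encoded by incidence matrices T, H : Matrix (Fin n) (Fin m) ℝ. Let M = fromBlocks (T * Hᵀ) J_{n,m} J_{m,n} (Hᵀ * T) (the adjacency matrix of the transformation D^{++1}, which keeps the arcs of D among the vertices, the line-digraph arcs among the arc-vertices, and has all arcs between the two parts in both directions). Then for every λ ∈ ℝ: (λ − r)² · det(λ·I_{n+m} − M) = λ^{m−n} · ((λ − r)² − m·n) · det(λ·I_n − T * Hᵀ)². -/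
open Matrix

/-- Spectrum of the transformation `D^{++1}` of an `r`-regular general digraph. -/
theorem spectrum_plus_plus_one (n r m : ℕ) (hn : 1 ≤ n) (hr : 1 ≤ r) (hm : m = n * r)
    (T H : Matrix (Fin n) (Fin m) ℝ)
    (hT01 : ∀ i e, T i e = 0 ∨ T i e = 1)
    (hH01 : ∀ i e, H i e = 0 ∨ H i e = 1)
    (hTcol : ∀ e, ∑ i, T i e = 1)
    (hHcol : ∀ e, ∑ i, H i e = 1)
    (hTrow : ∀ i, ∑ e, T i e = (r : ℝ))
    (hHrow : ∀ i, ∑ e, H i e = (r : ℝ))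
    (Jnm : Matrix (Fin n) (Fin m) ℝ) (hJnm : ∀ i e, Jnm i e = 1)
    (Jmn : Matrix (Fin m) (Fin n) ℝ) (hJmn : ∀ e i, Jmn e i = 1)
    (lam : ℝ) :
    (lam - (r : ℝ)) ^ 2 *
        (lam • (1 : Matrix (Fin n ⊕ Fin m) (Fin n ⊕ Fin m) ℝ)
          - Matrix.fromBlocks (T * Hᵀ) Jnm Jmn (Hᵀ * T)).det
      = lam ^ (m - n) * ((lam - (r : ℝ)) ^ 2 - (m : ℝ) * (n : ℝ)) *
        (lam • (1 : Matrix (Fin n) (Fin n) ℝ) - T * Hᵀ).det ^ 2 := by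
  have hmn : n ≤ m := by subst hm; exact Nat.le_mul_of_pos_right n hr
  have hTJ : ∀ (k : ℕ) (K : Matrix (Fin m) (Fin k) ℝ) (L : Matrix (Fin n) (Fin k) ℝ),
      (∀ i j, K i j = 1) → (∀ i j, L i j = 1) → T * K = (r : ℝ) • L := by
    intro k K L hK hL
    ext i j
    simp [Matrix.mul_apply, hK, hL, hTrow]
  have hHJ : ∀ (k : ℕ) (K : Matrix (Fin n) (Fin k) ℝ) (L : Matrix (Fin m) (Fin k) ℝ),
      (∀ i j, K i j = 1) → (∀ i j, L i j = 1) → Hᵀ * K = L := by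
    intro k K L hK hL
    ext i j
    simp [Matrix.mul_apply, hK, hL, hHcol]
  set P := lam • (1 : Matrix (Fin n) (Fin n) ℝ) - T * Hᵀ with hP
  set Q := lam • (1 : Matrix (Fin m) (Fin m) ℝ) - Hᵀ * T with hQ
  let Jm : Matrix (Fin m) (Fin m) ℝ := Matrix.of fun _ _ => 1
  have hJm : ∀ i j, Jm i j = 1 := fun _ _ => rfl
  have hPJ : P * Jnm = (lam - r) • Jnm := by
    rw [hP, Matrix.sub_mul, Matrix.mul_assoc, hHJ m Jnm Jm hJnm hJm, hTJ m Jm Jnm hJm hJnm,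
      Matrix.smul_mul, Matrix.one_mul, sub_smul]
  have hQJ : Q * Jm = (lam - r) • Jm := by
    rw [hQ, Matrix.sub_mul, Matrix.mul_assoc, hTJ m Jm Jnm hJm hJnm, Matrix.mul_smul,
      hHJ m Jnm Jm hJnm hJm, Matrix.smul_mul, Matrix.one_mul, sub_smul]
  have hdetQ : Q.det = lam ^ (m - n) * P.det := by
    have h := Matrix.charpoly_mul_comm_of_le (A := Hᵀ) (B := T) (by simpa using hmn)
    have h2 := congrArg (Polynomial.eval lam) h
    simp only [Polynomial.eval_mul, Polynomial.eval_pow, Polynomial.eval_X, Matrix.eval_charpoly,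
      Fintype.card_fin] at h2
    rw [hQ, hP, Matrix.smul_one_eq_diagonal, Matrix.smul_one_eq_diagonal]
    exact h2
  have hM : lam • (1 : Matrix (Fin n ⊕ Fin m) (Fin n ⊕ Fin m) ℝ)
          - Matrix.fromBlocks (T * Hᵀ) Jnm Jmn (Hᵀ * T) = Matrix.fromBlocks P (-Jnm) (-Jmn) Q := by
    rw [← Matrix.fromBlocks_one, Matrix.fromBlocks_smul, sub_eq_add_neg, Matrix.fromBlocks_neg,
      Matrix.fromBlocks_add]
    simp [hP, hQ, sub_eq_add_neg]
  rw [hM]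
  by_cases hs : lam - (r : ℝ) = 0
  · have hP0 : P.det = 0 := by
      apply Matrix.exists_mulVec_eq_zero_iff.mp
      refine ⟨fun _ => 1, ?_, ?_⟩
      · intro h
        simpa using congrFun h ⟨0, hn⟩
      · ext i
        have hmpos : 0 < m := by omega
        have := congrFun (congrFun hPJ i) ⟨0, hmpos⟩
        simpa [Matrix.mul_apply, Matrix.mulVec, dotProduct, hJnm, hs] using this
    rw [hs, hP0]; simp
  · set s := lam - (r : ℝ) with hsdef
    have hJJ : Jmn * Jnm = (n : ℝ) • Jm := by
      ext i j
      simp [Matrix.mul_apply, hJnm, hJmn, hJm]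
    have hU : (Matrix.fromBlocks P (-Jnm) (-Jmn) Q) * (Matrix.fromBlocks 1 (s⁻¹ • Jnm) 0 1)
        = Matrix.fromBlocks P 0 (-Jmn) (Q * (1 - ((n : ℝ) / s ^ 2) • Jm)) := by
      rw [Matrix.fromBlocks_multiply]
      congr 1
      · simp
      · rw [Matrix.mul_smul, hPJ, smul_smul, inv_mul_cancel₀ hs]; simp
      · simp
      · rw [Matrix.mul_sub, Matrix.mul_smul, Matrix.mul_smul, hQJ, Matrix.neg_mul, hJJ]
        ext i j
        simp [hJm]
        field_simp
        ring
    have hdJ : (1 - ((n : ℝ) / s ^ 2) • Jm).det = 1 - (n : ℝ) / s ^ 2 * m := by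
      have : ((n : ℝ) / s ^ 2) • Jm = Matrix.replicateCol Unit (fun _ => (n : ℝ) / s ^ 2)
          * Matrix.replicateRow Unit (fun _ => (1 : ℝ)) := by
        ext i j
        simp [Matrix.mul_apply, hJm]
      rw [this, Matrix.det_one_sub_mul_comm]
      simp [Matrix.mul_apply]
      ring
    have hd := congrArg Matrix.det hU
    rw [Matrix.det_mul, Matrix.det_fromBlocks_zero₂₁, Matrix.det_fromBlocks_zero₁₂, Matrix.det_mul,
      hdJ, hdetQ] at hd
    simp only [Matrix.det_one, mul_one] at hd
    rw [hd]
    field_simp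
end

section
/- Spectrum of D^{1+1}: Let D be a simple r-regular digraph with n ≥ 1 vertices and m = n·r arcs (r ≥ 1), encoded by incidence matrices T, H : Matrix (Fin n) (Fin m) ℝ. Let M = fromBlocks (J_{n,n} − I_n) J_{n,m} J_{m,n} (Hᵀ * T) (the adjacency matrix of the transformation D^{1+1}, with the complete simple digraph among the vertices, the line-digraph arcs among the arc-vertices, and all arcs between the two parts in both directions). Then for every λ ∈ ℝ: (λ − r) · det(λ·I_{n+m} − M) = λ^{m−n} · (λ + 1)^{n−1} · ((λ − r)·(λ + 1 − n) − m·n) · det(λ·I_n − T * Hᵀ). -/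
open Matrix

lemma det_mul_comm_aux {p q : ℕ} (h : q ≤ p) (A : Matrix (Fin p) (Fin q) ℝ) (B : Matrix (Fin q) (Fin p) ℝ) (a : ℝ) :
    (a • (1 : Matrix (Fin p) (Fin p) ℝ) - A * B).det
      = a ^ (p - q) * (a • (1 : Matrix (Fin q) (Fin q) ℝ) - B * A).det := by
  have := congrArg (Polynomial.eval a) (Matrix.charpoly_mul_comm_of_le A B (by simpa using h))
  simpa [Matrix.eval_charpoly, Matrix.smul_one_eq_diagonal] using this




/-- Spectrum of the transformation `D^{1+1}` of a simple `r`-regular digraph. -/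
theorem spectrum_one_plus_one (n r m : ℕ) (hn : 1 ≤ n) (hr : 1 ≤ r) (hm : m = n * r)
    (T H : Matrix (Fin n) (Fin m) ℝ)
    (hT01 : ∀ i e, T i e = 0 ∨ T i e = 1)
    (hH01 : ∀ i e, H i e = 0 ∨ H i e = 1)
    (hTcol : ∀ e, ∑ i, T i e = 1)
    (hHcol : ∀ e, ∑ i, H i e = 1)
    (hnoloop : ∀ e, ∑ v, T v e * H v e = 0)
    (hA01 : ∀ i j, (T * Hᵀ) i j = 0 ∨ (T * Hᵀ) i j = 1)
    (hTrow : ∀ i, ∑ e, T i e = (r : ℝ))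
    (hHrow : ∀ i, ∑ e, H i e = (r : ℝ))
    (Jnn : Matrix (Fin n) (Fin n) ℝ) (hJnn : ∀ i j, Jnn i j = 1)
    (Jnm : Matrix (Fin n) (Fin m) ℝ) (hJnm : ∀ i e, Jnm i e = 1)
    (Jmn : Matrix (Fin m) (Fin n) ℝ) (hJmn : ∀ e i, Jmn e i = 1)
    (lam : ℝ) :
    (lam - (r : ℝ)) *
        (lam • (1 : Matrix (Fin n ⊕ Fin m) (Fin n ⊕ Fin m) ℝ)
          - Matrix.fromBlocks (Jnn - 1) Jnm Jmn (Hᵀ * T)).det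
      = lam ^ (m - n) * (lam + 1) ^ (n - 1) *
          ((lam - (r : ℝ)) * (lam + 1 - (n : ℝ)) - (m : ℝ) * (n : ℝ)) *
        (lam • (1 : Matrix (Fin n) (Fin n) ℝ) - T * Hᵀ).det := by
  have hnm : n ≤ m := by rw [hm]; exact Nat.le_mul_of_pos_right n hr
  rcases eq_or_ne lam (r : ℝ) with hl | hl
  · have h0 : (lam • (1 : Matrix (Fin n) (Fin n) ℝ) - T * Hᵀ).det = 0 := by
      rw [← Matrix.exists_mulVec_eq_zero_iff]
      refine ⟨fun _ => 1, ?_, ?_⟩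
      · intro h
        have := congrFun h ⟨0, hn⟩
        simp at this
      · rw [Matrix.sub_mulVec, Matrix.smul_mulVec, Matrix.one_mulVec, ← Matrix.mulVec_mulVec]
        have h1 : Hᵀ *ᵥ (fun _ => (1 : ℝ)) = fun _ => 1 := by
          ext e
          simp [Matrix.mulVec, dotProduct, hHcol]
        rw [h1]
        ext i
        simp [Matrix.mulVec, dotProduct, hTrow, hl]
    rw [h0, hl]
    simp
  · have hne : lam - (r : ℝ) ≠ 0 := sub_ne_zero.mpr hl
    have e1 : (lam • (1 : Matrix (Fin n ⊕ Fin m) (Fin n ⊕ Fin m) ℝ)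
          - Matrix.fromBlocks (Jnn - 1) Jnm Jmn (Hᵀ * T)) =
        Matrix.fromBlocks (lam • 1 - (Jnn - 1)) (-Jnm) (-Jmn) (lam • 1 - Hᵀ * T) := by
      rw [← Matrix.fromBlocks_one, Matrix.fromBlocks_smul]
      ext (i | i) (j | j) <;> simp
    have hTJ : T * Jmn = (r : ℝ) • Jnn := by
      ext i j
      simp [Matrix.mul_apply, hJmn, hJnn, hTrow]
    have hHJ : Hᵀ * Jnn = Jmn := by
      ext i j
      simp [Matrix.mul_apply, hJmn, hJnn, hHcol]
    have hJJ : Jnm * Jmn = (m : ℝ) • Jnn := by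
      ext i j
      simp [Matrix.mul_apply, hJmn, hJnn, hJnm]
    let u : Matrix (Fin n) (Fin 1) ℝ := fun _ _ => (lam - r + m)
    let v : Matrix (Fin 1) (Fin n) ℝ := fun _ _ => 1
    have huv : u * v = (lam - r + m) • Jnn := by
      ext i j
      rw [Matrix.mul_apply]
      simp [u, v, hJnn]
    have hvu : (v * u) 0 0 = n * (lam - r + m) := by
      rw [Matrix.mul_apply]
      simp [u, v]
      ring
    have key : Matrix.fromBlocks (lam • 1 - (Jnn - 1)) (-Jnm) (-Jmn) (lam • 1 - Hᵀ * T) *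
        Matrix.fromBlocks ((lam - r) • 1) 0 Jmn 1 =
        Matrix.fromBlocks (((lam - r) * (lam + 1)) • 1 - u * v) (-Jnm) 0
          (lam • 1 - Hᵀ * T) := by
      rw [Matrix.fromBlocks_multiply]
      congr 1
      · rw [Matrix.neg_mul, hJJ, huv]
        ext i j
        simp [hJnn]
        ring
      · simp
      · rw [Matrix.sub_mul, Matrix.mul_assoc, hTJ, Matrix.mul_smul Hᵀ, hHJ]
        ext i j
        simp [hJmn]
      · simp
    have hd := congrArg Matrix.det key
    rw [Matrix.det_mul, Matrix.det_fromBlocks_zero₁₂, Matrix.det_fromBlocks_zero₂₁,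
      det_mul_comm_aux hn, det_mul_comm_aux hnm, ← e1] at hd
    have h1 : (((lam - r) * (lam + 1)) • (1 : Matrix (Fin 1) (Fin 1) ℝ) - v * u).det
        = (lam - (r : ℝ)) * (lam + 1 - (n : ℝ)) - (m : ℝ) * (n : ℝ) := by
      rw [Matrix.det_fin_one, Matrix.sub_apply, hvu]
      simp
      ring
    rw [h1] at hd
    simp only [Matrix.det_smul, Matrix.det_one, Fintype.card_fin, mul_one, mul_pow] at hd
    obtain ⟨k, rfl⟩ : ∃ k, n = k + 1 := ⟨n - 1, by omega⟩
    simp only [Nat.add_sub_cancel] at hd ⊢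
    apply mul_left_cancel₀ (pow_ne_zero k hne)
    rw [pow_succ] at hd
    linear_combination hd
end

section
/- Spectrum of D^{11+}: Let D be a simple r-regular digraph with n ≥ 1 vertices and m = n·r arcs (r ≥ 1), encoded by incidence matrices T, H : Matrix (Fin n) (Fin m) ℝ. Let M = fromBlocks (J_{n,n} − I_n) T Hᵀ (J_{m,m} − I_m) (the adjacency matrix of the transformation D^{11+}, with the complete simple digraph among the vertices and among the arc-vertices, an arc v→e when v is the tail of e, and an arc e→v when v is the head of e). Then for every λ ∈ ℝ: ((λ + 1)² − r) · det(λ·I_{n+m} − M) = (λ + 1)^{m−n} · ((λ + 1)² − r − n·((λ + 1)·(r + 1) − m)) · det((λ + 1)²·I_n − T * Hᵀ). -/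
open Matrix

lemma aux_det_update {p q : Type*} [Fintype p] [DecidableEq p] [Fintype q] [DecidableEq q]
    (K : Matrix p p ℝ) (U : Matrix p q ℝ) (V : Matrix q p ℝ) (C : Matrix q q ℝ)
    (h : K * U = U * C) :
    C.det * (K - U * V).det = K.det * (C - V * U).det := by
  have h1 : fromBlocks K U V 1 * fromBlocks 1 (-U) 0 C = fromBlocks K 0 V (C - V * U) := by
    rw [fromBlocks_multiply]
    simp [h, sub_eq_add_neg, add_comm]
  have h2 := congrArg Matrix.det h1
  rw [det_mul, det_fromBlocks_one₂₂, det_fromBlocks_zero₂₁, det_fromBlocks_zero₁₂, det_one,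
    one_mul] at h2
  rw [← h2, mul_comm]

lemma aux_det_K {n m : ℕ} (hnm : n ≤ m) (T H : Matrix (Fin n) (Fin m) ℝ) (x : ℝ) :
    (fromBlocks (x • (1 : Matrix (Fin n) (Fin n) ℝ)) (-T) (-Hᵀ)
      (x • (1 : Matrix (Fin m) (Fin m) ℝ))).det
      = x ^ (m - n) * ((x ^ 2) • (1 : Matrix (Fin n) (Fin n) ℝ) - T * Hᵀ).det := by
  have key : ∀ y : ℝ, y ≠ 0 →
    (fromBlocks (y • (1 : Matrix (Fin n) (Fin n) ℝ)) (-T) (-Hᵀ)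
      (y • (1 : Matrix (Fin m) (Fin m) ℝ))).det
      = y ^ (m - n) * ((y ^ 2) • (1 : Matrix (Fin n) (Fin n) ℝ) - T * Hᵀ).det := by
    intro y hy
    have h1 : fromBlocks (y • (1 : Matrix (Fin n) (Fin n) ℝ)) (-T) (-Hᵀ)
        (y • (1 : Matrix (Fin m) (Fin m) ℝ)) * fromBlocks (y • 1) 0 Hᵀ 1
        = fromBlocks ((y ^ 2) • (1 : Matrix (Fin n) (Fin n) ℝ) - T * Hᵀ) (-T) 0 (y • 1) := by
      rw [fromBlocks_multiply]
      simp [sub_eq_add_neg, smul_smul, pow_two]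
    have h2 := congrArg Matrix.det h1
    rw [det_mul, det_fromBlocks_zero₁₂, det_fromBlocks_zero₂₁, det_one, det_smul, det_smul,
      det_one, det_one, Fintype.card_fin, Fintype.card_fin] at h2
    have h3 : y ^ m = y ^ (m - n) * y ^ n := by rw [← pow_add, Nat.sub_add_cancel hnm]
    rw [h3] at h2
    have h4 : y ^ n ≠ 0 := pow_ne_zero _ hy
    apply mul_right_cancel₀ h4
    linear_combination h2
  have hd : Dense ({0}ᶜ : Set ℝ) := dense_compl_singleton 0
  have := Continuous.ext_on (f := fun y : ℝ =>
    (fromBlocks (y • (1 : Matrix (Fin n) (Fin n) ℝ)) (-T) (-Hᵀ)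
      (y • (1 : Matrix (Fin m) (Fin m) ℝ))).det)
    (g := fun y => y ^ (m - n) * ((y ^ 2) • (1 : Matrix (Fin n) (Fin n) ℝ) - T * Hᵀ).det)
    hd ?_ ?_ (fun y hy => key y hy)
  · exact congrFun this x
  · apply Continuous.matrix_det
    apply Continuous.matrix_fromBlocks <;> fun_prop
  · apply Continuous.mul (by fun_prop)
    apply Continuous.matrix_det
    fun_prop

/-- Spectrum of the transformation `D^{11+}` of a simple `r`-regular digraph. -/
theorem spectrum_one_one_plus (n r m : ℕ) (hn : 1 ≤ n) (hr : 1 ≤ r) (hm : m = n * r)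
    (T H : Matrix (Fin n) (Fin m) ℝ)
    (hT01 : ∀ i e, T i e = 0 ∨ T i e = 1)
    (hH01 : ∀ i e, H i e = 0 ∨ H i e = 1)
    (hTcol : ∀ e, ∑ i, T i e = 1)
    (hHcol : ∀ e, ∑ i, H i e = 1)
    (hnoloop : ∀ e, ∑ v, T v e * H v e = 0)
    (hA01 : ∀ i j, (T * Hᵀ) i j = 0 ∨ (T * Hᵀ) i j = 1)
    (hTrow : ∀ i, ∑ e, T i e = (r : ℝ))
    (hHrow : ∀ i, ∑ e, H i e = (r : ℝ))
    (Jnn : Matrix (Fin n) (Fin n) ℝ) (hJnn : ∀ i j, Jnn i j = 1)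
    (Jmm : Matrix (Fin m) (Fin m) ℝ) (hJmm : ∀ e f, Jmm e f = 1)
    (lam : ℝ) :
    ((lam + 1) ^ 2 - (r : ℝ)) *
        (lam • (1 : Matrix (Fin n ⊕ Fin m) (Fin n ⊕ Fin m) ℝ)
          - Matrix.fromBlocks (Jnn - 1) T Hᵀ (Jmm - 1)).det
      = (lam + 1) ^ (m - n) *
          ((lam + 1) ^ 2 - (r : ℝ) - (n : ℝ) * ((lam + 1) * ((r : ℝ) + 1) - (m : ℝ))) *
        (((lam + 1) ^ 2) • (1 : Matrix (Fin n) (Fin n) ℝ) - T * Hᵀ).det := by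
  have hnm : n ≤ m := by rw [hm]; exact Nat.le_mul_of_pos_right n hr
  have hmr : (m : ℝ) = n * r := by rw [hm]; push_cast; rfl
  rw [mul_assoc, mul_comm (_ - _ - _), ← mul_assoc, ← aux_det_K hnm]
  let U : Matrix (Fin n ⊕ Fin m) (Fin 2) ℝ :=
    Matrix.of (Sum.elim (fun _ => ![1, 0]) (fun _ => ![0, 1]))
  let C : Matrix (Fin 2) (Fin 2) ℝ := !![lam + 1, -(r : ℝ); -1, lam + 1]
  have h := aux_det_update (fromBlocks ((lam + 1) • (1 : Matrix (Fin n) (Fin n) ℝ)) (-T) (-Hᵀ)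
      ((lam + 1) • (1 : Matrix (Fin m) (Fin m) ℝ))) U Uᵀ C ?_
  · have e1 : C.det = (lam + 1) ^ 2 - r := by
      simp [C, det_fin_two]; ring
    have e2 : (C - Uᵀ * U).det =
        (lam + 1) ^ 2 - (r : ℝ) - (n : ℝ) * ((lam + 1) * ((r : ℝ) + 1) - (m : ℝ)) := by
      simp [C, U, det_fin_two, Matrix.mul_apply]
      rw [hmr]; ring
    rw [e1, e2] at h
    rw [← h]
    congr 2
    ext i j
    rcases i with i | i <;> rcases j with j | j <;>
      simp [U, Matrix.mul_apply, hJnn, hJmm, Matrix.one_apply] <;> split_ifs <;> ring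
  · ext i j
    rcases i with i | i <;> fin_cases j <;>
      simp [U, C, Matrix.mul_apply, Matrix.one_apply, hTrow, hHcol]
end

section
/- Spectrum and cospectrality of D^{+0−} and D^{0+−}: Let D be an r-regular digraph (loops and multiple arcs allowed) with n ≥ 1 vertices and m = n·r arcs (r ≥ 1), encoded by incidence matrices T, H : Matrix (Fin n) (Fin m) ℝ. Let M₁ = fromBlocks (T * Hᵀ) (J_{n,m} − T) (J_{m,n} − Hᵀ) 0 (the adjacency matrix of D^{+0−}) and M₂ = fromBlocks 0 (J_{n,m} − T) (J_{m,n} − Hᵀ) (Hᵀ * T) (the adjacency matrix of D^{0+−}). Then for every λ ∈ ℝ: det(λ·I_{n+m} − M₁) = det(λ·I_{n+m} − M₂), and (λ² − r·(λ + 1)) · det(λ·I_{n+m} − M₁) = λ^{m−n} · (λ² − r·(λ + 1) + 2·m − m·n) · det(λ²·I_n − (λ + 1)·(T * Hᵀ)). -/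
open Matrix

lemma aux_sylv {n m : ℕ} (x : ℝ) (hx : x ≠ 0) (X : Matrix (Fin m) (Fin n) ℝ)
    (Y : Matrix (Fin n) (Fin m) ℝ) :
    x ^ n * (x • (1 : Matrix (Fin m) (Fin m) ℝ) - X * Y).det
      = x ^ m * (x • (1 : Matrix (Fin n) (Fin n) ℝ) - Y * X).det := by
  have h1 : x • (1 : Matrix (Fin m) (Fin m) ℝ) - X * Y = x • (1 - (x⁻¹ • X) * Y) := by
    rw [smul_sub, Matrix.smul_mul, smul_smul, mul_inv_cancel₀ hx, one_smul]
  have h2 : x • (1 : Matrix (Fin n) (Fin n) ℝ) - Y * X = x • (1 - Y * (x⁻¹ • X)) := by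
    rw [smul_sub, Matrix.mul_smul, smul_smul, mul_inv_cancel₀ hx, one_smul]
  rw [h1, h2, Matrix.det_smul, Matrix.det_smul, Matrix.det_one_sub_mul_comm]
  simp only [Fintype.card_fin]
  ring

lemma aux_schur1 {n m : ℕ} (x : ℝ) (hx : x ≠ 0) (A : Matrix (Fin n) (Fin n) ℝ)
    (B : Matrix (Fin n) (Fin m) ℝ) (C : Matrix (Fin m) (Fin n) ℝ) :
    x ^ n * (x • (1 : Matrix (Fin n ⊕ Fin m) (Fin n ⊕ Fin m) ℝ)
      - Matrix.fromBlocks A B C 0).det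
      = x ^ m * ((x ^ 2) • (1 : Matrix (Fin n) (Fin n) ℝ) - x • A - B * C).det := by
  have h0 : (x • (1 : Matrix (Fin n ⊕ Fin m) (Fin n ⊕ Fin m) ℝ)
      - Matrix.fromBlocks A B C 0)
      = Matrix.fromBlocks (x • 1 - A) (-B) (-C) (x • 1) := by
    rw [← Matrix.fromBlocks_one, Matrix.fromBlocks_smul, sub_eq_add_neg, Matrix.fromBlocks_neg,
      Matrix.fromBlocks_add]
    simp [sub_eq_add_neg]
  have hinv : (x⁻¹ • (1 : Matrix (Fin m) (Fin m) ℝ)) * (x • 1) = 1 := by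
    simp [smul_smul, hx]
  letI : Invertible (x • (1 : Matrix (Fin m) (Fin m) ℝ)) :=
    ⟨x⁻¹ • 1, hinv, by simp [smul_smul, hx]⟩
  have hi : ⅟(x • (1 : Matrix (Fin m) (Fin m) ℝ)) = x⁻¹ • 1 := rfl
  rw [h0, Matrix.det_fromBlocks₂₂, hi]
  have h2 : (x ^ 2) • (1 : Matrix (Fin n) (Fin n) ℝ) - x • A - B * C
      = x • (x • 1 - A - -B * x⁻¹ • (1 : Matrix (Fin m) (Fin m) ℝ) * -C) := by
    simp [smul_sub, smul_smul, hx, pow_two]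
  rw [h2, Matrix.det_smul, Matrix.det_smul]
  simp only [Fintype.card_fin, Matrix.det_one]
  ring

lemma aux_schur2 {n m : ℕ} (x : ℝ) (hx : x ≠ 0) (A : Matrix (Fin m) (Fin m) ℝ)
    (B : Matrix (Fin n) (Fin m) ℝ) (C : Matrix (Fin m) (Fin n) ℝ) :
    x ^ m * (x • (1 : Matrix (Fin n ⊕ Fin m) (Fin n ⊕ Fin m) ℝ)
      - Matrix.fromBlocks 0 B C A).det
      = x ^ n * ((x ^ 2) • (1 : Matrix (Fin m) (Fin m) ℝ) - x • A - C * B).det := by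
  rw [← aux_schur1 x hx A C B]
  congr 1
  rw [← Matrix.det_submatrix_equiv_self (Equiv.sumComm (Fin m) (Fin n))]
  congr 1
  ext i j
  rcases i with i | i <;> rcases j with j | j <;> simp [Matrix.one_apply]

lemma aux_rank1 {n : ℕ} (B : Matrix (Fin n) (Fin n) ℝ) (μ c : ℝ) (hμ : μ ≠ 0)
    (hB : B * (Matrix.of fun _ _ => (1 : ℝ)) = μ • (Matrix.of fun _ _ => (1 : ℝ) : Matrix (Fin n) (Fin n) ℝ)) :
    μ * (B - c • (Matrix.of fun _ _ => (1 : ℝ))).det = (μ - c * n) * B.det := by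
  have h1 : B - c • (Matrix.of fun _ _ => (1 : ℝ)) =
      B * (1 - (Matrix.of fun (_ : Fin n) (_ : Unit) => (c / μ)) *
        (Matrix.of fun (_ : Unit) (_ : Fin n) => (1 : ℝ))) := by
    have : (Matrix.of fun (_ : Fin n) (_ : Unit) => (c / μ)) *
        (Matrix.of fun (_ : Unit) (_ : Fin n) => (1 : ℝ)) =
        (c / μ) • (Matrix.of fun _ _ => (1 : ℝ)) := by
      ext i j
      simp [Matrix.mul_apply]
    rw [this, Matrix.mul_sub, Matrix.mul_smul, hB, smul_smul, div_mul_cancel₀ _ hμ, Matrix.mul_one]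
  rw [h1, Matrix.det_mul, Matrix.det_one_sub_mul_comm, Matrix.det_unique (n := Unit)]
  simp [Matrix.mul_apply]
  field_simp

lemma aux_dense (r : ℝ) : Dense {x : ℝ | x ≠ 0 ∧ x ^ 2 - r * (x + 1) ≠ 0} := by
  have hf : {x : ℝ | x * (x ^ 2 - r * (x + 1)) = 0}.Finite := by
    let p : Polynomial ℝ :=
      Polynomial.X * (Polynomial.X ^ 2 - Polynomial.C r * (Polynomial.X + 1))
    have hp : p ≠ 0 := by
      intro h
      have := congrArg (Polynomial.eval (-1)) h
      simp [p] at this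
    refine (p.roots.toFinset.finite_toSet).subset ?_
    intro x hx
    simp only [Set.mem_setOf_eq] at hx
    simp only [Finset.mem_coe, Multiset.mem_toFinset, Polynomial.mem_roots hp,
      Polynomial.IsRoot.def]
    simpa [p] using hx
  have := hf.countable.dense_compl ℝ
  refine this.mono ?_
  intro x hx
  simpa [not_or] using hx

/-- Spectrum and cospectrality of the transformations `D^{+0-}` and `D^{0+-}`
of an `r`-regular general digraph. -/
theorem spectrum_plus_zero_minus_and_zero_plus_minus
    (n r m : ℕ) (hn : 1 ≤ n) (hr : 1 ≤ r) (hm : m = n * r)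
    (T H : Matrix (Fin n) (Fin m) ℝ)
    (hT01 : ∀ i e, T i e = 0 ∨ T i e = 1)
    (hH01 : ∀ i e, H i e = 0 ∨ H i e = 1)
    (hTcol : ∀ e, ∑ i, T i e = 1)
    (hHcol : ∀ e, ∑ i, H i e = 1)
    (hTrow : ∀ i, ∑ e, T i e = (r : ℝ))
    (hHrow : ∀ i, ∑ e, H i e = (r : ℝ))
    (Jnm : Matrix (Fin n) (Fin m) ℝ) (hJnm : ∀ i e, Jnm i e = 1)
    (Jmn : Matrix (Fin m) (Fin n) ℝ) (hJmn : ∀ e i, Jmn e i = 1)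
    (lam : ℝ) :
    (lam • (1 : Matrix (Fin n ⊕ Fin m) (Fin n ⊕ Fin m) ℝ)
        - Matrix.fromBlocks (T * Hᵀ) (Jnm - T) (Jmn - Hᵀ) 0).det
      = (lam • (1 : Matrix (Fin n ⊕ Fin m) (Fin n ⊕ Fin m) ℝ)
        - Matrix.fromBlocks 0 (Jnm - T) (Jmn - Hᵀ) (Hᵀ * T)).det
    ∧ (lam ^ 2 - (r : ℝ) * (lam + 1)) *
        (lam • (1 : Matrix (Fin n ⊕ Fin m) (Fin n ⊕ Fin m) ℝ)
          - Matrix.fromBlocks (T * Hᵀ) (Jnm - T) (Jmn - Hᵀ) 0).det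
      = lam ^ (m - n) *
          (lam ^ 2 - (r : ℝ) * (lam + 1) + 2 * (m : ℝ) - (m : ℝ) * (n : ℝ)) *
        ((lam ^ 2) • (1 : Matrix (Fin n) (Fin n) ℝ) - (lam + 1) • (T * Hᵀ)).det := by
  have hmn : n ≤ m := by subst hm; exact Nat.le_mul_of_pos_right _ hr
  set J : Matrix (Fin n) (Fin n) ℝ := Matrix.of fun _ _ => (1 : ℝ) with hJ
  have hmr : (m : ℝ) = n * r := by rw [hm]; push_cast; ring
  -- product computations
  have e1 : (Jnm - T) * (Jmn - Hᵀ) = T * Hᵀ + ((m : ℝ) - 2 * r) • J := by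
    ext i j
    simp only [Matrix.mul_apply, Matrix.sub_apply, Matrix.add_apply, Matrix.smul_apply,
      Matrix.transpose_apply, hJnm, hJmn, hJ, Matrix.of_apply, smul_eq_mul]
    have : ∀ e, (1 - T i e) * (1 - H j e) = 1 - T i e - H j e + T i e * H j e := by
      intro e; ring
    simp only [this, Finset.sum_add_distrib, Finset.sum_sub_distrib, hTrow, hHrow]
    simp
    ring
  have e2 : (Jmn - Hᵀ) * (Jnm - T) = Hᵀ * (T + ((n : ℝ) - 2) • Jnm) := by
    ext i j
    simp only [Matrix.mul_apply, Matrix.sub_apply, Matrix.add_apply, Matrix.smul_apply,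
      Matrix.transpose_apply, hJnm, hJmn, smul_eq_mul]
    have : ∀ e, (1 - H e i) * (1 - T e j) = 1 - H e i - T e j + H e i * T e j := by
      intro e; ring
    simp only [this, mul_add, Finset.sum_add_distrib, Finset.sum_sub_distrib, hTcol, hHcol,
      ← Finset.sum_mul]
    simp
    ring
  have e3 : Jnm * Hᵀ = (r : ℝ) • J := by
    ext i j
    simp [Matrix.mul_apply, hJnm, hHrow, hJ]
  have e4 : (T * Hᵀ) * J = (r : ℝ) • J := by
    have a : Hᵀ * J = Jmn := by
      ext i j
      simp [Matrix.mul_apply, hJmn, hHcol, hJ]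
    have b : T * Jmn = (r : ℝ) • J := by
      ext i j
      simp [Matrix.mul_apply, hJmn, hTrow, hJ]
    rw [Matrix.mul_assoc, a, b]
  have d1 : ∀ x : ℝ, x ≠ 0 → (x • (1 : Matrix (Fin n ⊕ Fin m) (Fin n ⊕ Fin m) ℝ)
        - Matrix.fromBlocks (T * Hᵀ) (Jnm - T) (Jmn - Hᵀ) 0).det
      = x ^ (m - n) * ((x ^ 2) • (1 : Matrix (Fin n) (Fin n) ℝ) - (x + 1) • (T * Hᵀ)
          - ((m : ℝ) - 2 * r) • J).det := by
    intro x hx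
    have h := aux_schur1 x hx (T * Hᵀ) (Jnm - T) (Jmn - Hᵀ)
    have e : (x ^ 2) • (1 : Matrix (Fin n) (Fin n) ℝ) - x • (T * Hᵀ) - (Jnm - T) * (Jmn - Hᵀ)
        = (x ^ 2) • (1 : Matrix (Fin n) (Fin n) ℝ) - (x + 1) • (T * Hᵀ)
          - ((m : ℝ) - 2 * r) • J := by
      rw [e1, add_smul, one_smul]; abel
    rw [e] at h
    apply mul_left_cancel₀ (pow_ne_zero n hx)
    rw [h, ← mul_assoc, ← pow_add, Nat.add_sub_cancel' hmn]
  have d2 : ∀ x : ℝ, x ≠ 0 → (x • (1 : Matrix (Fin n ⊕ Fin m) (Fin n ⊕ Fin m) ℝ)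
        - Matrix.fromBlocks 0 (Jnm - T) (Jmn - Hᵀ) (Hᵀ * T)).det
      = x ^ (m - n) * ((x ^ 2) • (1 : Matrix (Fin n) (Fin n) ℝ) - (x + 1) • (T * Hᵀ)
          - ((m : ℝ) - 2 * r) • J).det := by
    intro x hx
    have h := aux_schur2 x hx (Hᵀ * T) (Jnm - T) (Jmn - Hᵀ)
    have e : (x ^ 2) • (1 : Matrix (Fin m) (Fin m) ℝ) - x • (Hᵀ * T) - (Jmn - Hᵀ) * (Jnm - T)
        = (x ^ 2) • (1 : Matrix (Fin m) (Fin m) ℝ)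
          - Hᵀ * ((x + 1) • T + ((n : ℝ) - 2) • Jnm) := by
      rw [e2, add_smul, one_smul]
      simp only [Matrix.mul_add, Matrix.mul_smul]
      abel
    have s := aux_sylv (x ^ 2) (pow_ne_zero 2 hx) Hᵀ ((x + 1) • T + ((n : ℝ) - 2) • Jnm)
    have e' : (x ^ 2) • (1 : Matrix (Fin n) (Fin n) ℝ)
          - ((x + 1) • T + ((n : ℝ) - 2) • Jnm) * Hᵀ
        = (x ^ 2) • (1 : Matrix (Fin n) (Fin n) ℝ) - (x + 1) • (T * Hᵀ)
          - ((m : ℝ) - 2 * r) • J := by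
      rw [Matrix.add_mul, Matrix.smul_mul, Matrix.smul_mul, e3, smul_smul, hmr, sub_mul]
      abel
    rw [e] at h
    rw [e'] at s
    obtain ⟨k, rfl⟩ := Nat.exists_eq_add_of_le hmn
    rw [Nat.add_sub_cancel_left]
    apply mul_left_cancel₀ (pow_ne_zero (n + (n + k)) hx)
    rw [pow_add, mul_assoc, h]
    have s' := s
    rw [← pow_mul, ← pow_mul] at s'
    calc _ = x ^ (2 * n) * _ := by rw [← mul_assoc, ← pow_add, ← two_mul]
      _ = _ := s'
      _ = _ := by ring
  have c1 : ∀ (M : Matrix (Fin n ⊕ Fin m) (Fin n ⊕ Fin m) ℝ),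
      Continuous fun x : ℝ => (x • (1 : Matrix (Fin n ⊕ Fin m) (Fin n ⊕ Fin m) ℝ) - M).det := by
    intro M
    exact Continuous.matrix_det (by fun_prop)
  have c2 : Continuous fun x : ℝ =>
      ((x ^ 2) • (1 : Matrix (Fin n) (Fin n) ℝ) - (x + 1) • (T * Hᵀ)).det :=
    Continuous.matrix_det (by fun_prop)
  have hd := aux_dense (r : ℝ)
  constructor
  · refine congrFun (Continuous.ext_on hd (c1 _) (c1 _) ?_) lam
    intro x hx
    simp only
    rw [d1 x hx.1, d2 x hx.1]
  · have c3 := c1 (Matrix.fromBlocks (T * Hᵀ) (Jnm - T) (Jmn - Hᵀ) 0)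
    refine congrFun (Continuous.ext_on hd
      (f := fun lam : ℝ => (lam ^ 2 - (r : ℝ) * (lam + 1)) *
        (lam • (1 : Matrix (Fin n ⊕ Fin m) (Fin n ⊕ Fin m) ℝ)
          - Matrix.fromBlocks (T * Hᵀ) (Jnm - T) (Jmn - Hᵀ) 0).det)
      (g := fun lam : ℝ => lam ^ (m - n) *
          (lam ^ 2 - (r : ℝ) * (lam + 1) + 2 * (m : ℝ) - (m : ℝ) * (n : ℝ)) *
        ((lam ^ 2) • (1 : Matrix (Fin n) (Fin n) ℝ) - (lam + 1) • (T * Hᵀ)).det)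
      (Continuous.mul (by fun_prop) c3) (Continuous.mul (by fun_prop) c2) ?_) lam
    intro x hx
    simp only
    rw [d1 x hx.1]
    have h := aux_rank1 ((x ^ 2) • (1 : Matrix (Fin n) (Fin n) ℝ) - (x + 1) • (T * Hᵀ))
      (x ^ 2 - (r : ℝ) * (x + 1)) ((m : ℝ) - 2 * r) hx.2 (by
        rw [← hJ, Matrix.sub_mul, Matrix.smul_mul, Matrix.smul_mul, e4, Matrix.one_mul, smul_smul,
          ← sub_smul, mul_comm (r : ℝ)])
    rw [← hJ] at h
    rw [mul_left_comm, h, mul_assoc]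
    congr 2
    rw [hmr]; ring
end

section
/- Spectrum of D^{++−}: Let D be an r-regular digraph (loops and multiple arcs allowed) with n ≥ 1 vertices and m = n·r arcs (r ≥ 1), encoded by incidence matrices T, H : Matrix (Fin n) (Fin m) ℝ, and let A = T * Hᵀ. Let M = fromBlocks A (J_{n,m} − T) (J_{m,n} − Hᵀ) (Hᵀ * T) (the adjacency matrix of the transformation D^{++−}: the arcs of D among the vertices, the line-digraph arcs among the arc-vertices, an arc v→e exactly when v is NOT the tail of e, and an arc e→v exactly when v is NOT the head of e). Then for every λ ∈ ℝ: (λ² − r·(2λ + 1) + r²) · det(λ·I_{n+m} − M) = λ^{m−n} · (λ² − r·(2λ + 1) + r² + 2·m − m·n) · det(λ²·I_n − (2λ + 1)·A + A²). -/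
open Matrix

theorem aux_det_K0 (n m : ℕ) (hnm : n ≤ m) (T H : Matrix (Fin n) (Fin m) ℝ) (lam : ℝ) :
    (fromBlocks (lam • (1 : Matrix (Fin n) (Fin n) ℝ) - T * Hᵀ) T Hᵀ
      (lam • (1 : Matrix (Fin m) (Fin m) ℝ) - Hᵀ * T)).det
    = lam ^ (m - n) * ((lam ^ 2) • (1 : Matrix (Fin n) (Fin n) ℝ)
        - (2 * lam + 1) • (T * Hᵀ) + (T * Hᵀ) ^ 2).det := by
  have key : ∀ x : ℝ, x ≠ 0 →
    (fromBlocks (x • (1 : Matrix (Fin n) (Fin n) ℝ) - T * Hᵀ) T Hᵀ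
      (x • (1 : Matrix (Fin m) (Fin m) ℝ) - Hᵀ * T)).det
    = x ^ (m - n) * ((x ^ 2) • (1 : Matrix (Fin n) (Fin n) ℝ)
        - (2 * x + 1) • (T * Hᵀ) + (T * Hᵀ) ^ 2).det := by
    intro x hx
    have h : fromBlocks (x • (1 : Matrix (Fin n) (Fin n) ℝ) - T * Hᵀ) T Hᵀ
      (x • (1 : Matrix (Fin m) (Fin m) ℝ) - Hᵀ * T) * fromBlocks 1 T 0 1
        * fromBlocks (x • 1) 0 (-Hᵀ) 1 =
      fromBlocks ((x ^ 2) • (1 : Matrix (Fin n) (Fin n) ℝ)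
        - (2 * x + 1) • (T * Hᵀ) + (T * Hᵀ) ^ 2)
        ((x • (1 : Matrix (Fin n) (Fin n) ℝ) - T * Hᵀ) * T + T) 0 (x • 1) := by
      rw [fromBlocks_multiply, fromBlocks_multiply]
      congr 1
      · simp only [Matrix.mul_one, Matrix.mul_zero, add_zero, Matrix.mul_smul, Matrix.mul_neg,
          Matrix.sub_mul, Matrix.add_mul, Matrix.smul_mul, Matrix.one_mul, pow_two,
          Matrix.mul_assoc]
        module
      · simp
      · simp
      · simp
    have h2 := congrArg Matrix.det h
    rw [det_mul, det_mul, det_fromBlocks_zero₂₁, det_fromBlocks_zero₁₂, det_fromBlocks_zero₂₁] at h2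
    simp only [det_one, det_smul, Fintype.card_fin, mul_one] at h2
    have h3 : x ^ m = x ^ (m - n) * x ^ n := by rw [← pow_add, Nat.sub_add_cancel hnm]
    rw [h3] at h2
    apply mul_right_cancel₀ (pow_ne_zero n hx)
    rw [h2]; ring
  have := Continuous.ext_on (dense_compl_singleton (0 : ℝ)) (f := fun x : ℝ =>
    (fromBlocks (x • (1 : Matrix (Fin n) (Fin n) ℝ) - T * Hᵀ) T Hᵀ
      (x • (1 : Matrix (Fin m) (Fin m) ℝ) - Hᵀ * T)).det) (g := fun x : ℝ =>
      x ^ (m - n) * ((x ^ 2) • (1 : Matrix (Fin n) (Fin n) ℝ)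
        - (2 * x + 1) • (T * Hᵀ) + (T * Hᵀ) ^ 2).det)
    (by
      apply Continuous.matrix_det
      apply Continuous.matrix_fromBlocks <;> fun_prop)
    (by
      apply Continuous.mul
      · fun_prop
      · apply Continuous.matrix_det
        fun_prop)
    (fun x hx => key x hx)
  exact congrFun this lam

theorem aux_pert {N : Type*} [Fintype N] [DecidableEq N] (K : Matrix N N ℝ)
    (U : Matrix N (Fin 2) ℝ) (G S : Matrix (Fin 2) (Fin 2) ℝ) (hG : G.det ≠ 0)
    (h : K * U = U * G) :
    G.det * (K - U * S * Uᵀ).det = (G - S * (Uᵀ * U)).det * K.det := by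
  have hu : IsUnit G.det := isUnit_iff_ne_zero.mpr hG
  have hU : U = K * U * G⁻¹ := by
    rw [h, Matrix.mul_assoc, Matrix.mul_nonsing_inv _ hu, Matrix.mul_one]
  have h1 : K - U * S * Uᵀ = K * (1 - U * (G⁻¹ * S * Uᵀ)) := by
    rw [Matrix.mul_sub, Matrix.mul_one]
    conv_lhs => rw [show U * S * Uᵀ = (K * U * G⁻¹) * S * Uᵀ by rw [← hU]]
    simp only [Matrix.mul_assoc]
  have h2 : G - S * (Uᵀ * U) = G * (1 - (G⁻¹ * S * Uᵀ) * U) := by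
    rw [Matrix.mul_sub, Matrix.mul_one]
    congr 1
    simp only [Matrix.mul_assoc]
    rw [Matrix.mul_nonsing_inv_cancel_left _ _ hu]
  rw [h1, h2, det_mul, det_mul, det_one_sub_mul_comm]
  ring

/-- Spectrum of the transformation `D^{++-}` of an `r`-regular general digraph. -/
theorem spectrum_plus_plus_minus (n r m : ℕ) (hn : 1 ≤ n) (hr : 1 ≤ r) (hm : m = n * r)
    (T H : Matrix (Fin n) (Fin m) ℝ)
    (hT01 : ∀ i e, T i e = 0 ∨ T i e = 1)
    (hH01 : ∀ i e, H i e = 0 ∨ H i e = 1)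
    (hTcol : ∀ e, ∑ i, T i e = 1)
    (hHcol : ∀ e, ∑ i, H i e = 1)
    (hTrow : ∀ i, ∑ e, T i e = (r : ℝ))
    (hHrow : ∀ i, ∑ e, H i e = (r : ℝ))
    (Jnm : Matrix (Fin n) (Fin m) ℝ) (hJnm : ∀ i e, Jnm i e = 1)
    (Jmn : Matrix (Fin m) (Fin n) ℝ) (hJmn : ∀ e i, Jmn e i = 1)
    (A : Matrix (Fin n) (Fin n) ℝ) (hA : A = T * Hᵀ)
    (lam : ℝ) :
    (lam ^ 2 - (r : ℝ) * (2 * lam + 1) + (r : ℝ) ^ 2) *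
        (lam • (1 : Matrix (Fin n ⊕ Fin m) (Fin n ⊕ Fin m) ℝ)
          - Matrix.fromBlocks A (Jnm - T) (Jmn - Hᵀ) (Hᵀ * T)).det
      = lam ^ (m - n) *
          (lam ^ 2 - (r : ℝ) * (2 * lam + 1) + (r : ℝ) ^ 2
            + 2 * (m : ℝ) - (m : ℝ) * (n : ℝ)) *
        ((lam ^ 2) • (1 : Matrix (Fin n) (Fin n) ℝ) - (2 * lam + 1) • A + A ^ 2).det := by
  have hnm : n ≤ m := by rw [hm]; exact Nat.le_mul_of_pos_right n hr
  have hA1 : A *ᵥ (fun _ => 1) = fun _ => (r : ℝ) := by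
    have e1 : Hᵀ *ᵥ (fun _ => (1 : ℝ)) = fun _ => 1 := by
      ext e; simp [Matrix.mulVec, dotProduct, hHcol]
    rw [hA, ← Matrix.mulVec_mulVec, e1]
    ext i; simp [Matrix.mulVec, dotProduct, hTrow]
  by_cases hφ : lam ^ 2 - (r : ℝ) * (2 * lam + 1) + (r : ℝ) ^ 2 = 0
  · have hz : ((lam ^ 2) • (1 : Matrix (Fin n) (Fin n) ℝ) - (2 * lam + 1) • A + A ^ 2).det = 0 := by
      apply Matrix.exists_mulVec_eq_zero_iff.mp
      refine ⟨fun _ => 1, ?_, ?_⟩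
      · intro h
        have := congrFun h ⟨0, hn⟩
        simp at this
      · have hr1 : (fun _ : Fin n => (r : ℝ)) = (r : ℝ) • (fun _ => 1) := by ext; simp
        rw [Matrix.add_mulVec, Matrix.sub_mulVec, Matrix.smul_mulVec, Matrix.smul_mulVec,
          pow_two A, ← Matrix.mulVec_mulVec, hA1, hr1, Matrix.mulVec_smul, hA1]
        ext i
        simp
        linarith
    rw [hφ, hz]; ring
  · let U : Matrix (Fin n ⊕ Fin m) (Fin 2) ℝ :=
      Matrix.of fun x j => Sum.elim (fun _ => ![1, 0] j) (fun _ => ![0, 1] j) x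
    let G : Matrix (Fin 2) (Fin 2) ℝ := !![lam - r, r; 1, lam - r]
    let S : Matrix (Fin 2) (Fin 2) ℝ := !![0, 1; 1, 0]
    have hGd : G.det = lam ^ 2 - (r : ℝ) * (2 * lam + 1) + (r : ℝ) ^ 2 := by
      simp only [G, Matrix.det_fin_two_of]; ring
    have hAi : ∀ i, ∑ j, A i j = (r : ℝ) := by
      intro i; simpa [Matrix.mulVec, dotProduct] using congrFun hA1 i
    have hL : ∀ e, ∑ f, (Hᵀ * T) e f = (r : ℝ) := by
      intro e
      simp only [Matrix.mul_apply, Matrix.transpose_apply]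
      rw [Finset.sum_comm]
      simp only [← Finset.mul_sum, hTrow, ← Finset.sum_mul, hHcol, one_mul]
    have hKU : fromBlocks (lam • (1 : Matrix (Fin n) (Fin n) ℝ) - A) T Hᵀ
        (lam • (1 : Matrix (Fin m) (Fin m) ℝ) - Hᵀ * T) * U = U * G := by
      generalize Hᵀ * T = L at hL
      ext x j
      rcases x with i | e <;> fin_cases j <;>
        simp [Matrix.mul_apply, Fintype.sum_sum_type, U, G, hAi, hL,
          hTrow, hHcol, Finset.sum_sub_distrib, Matrix.one_apply]
    have hM : lam • (1 : Matrix (Fin n ⊕ Fin m) (Fin n ⊕ Fin m) ℝ)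
          - Matrix.fromBlocks A (Jnm - T) (Jmn - Hᵀ) (Hᵀ * T) =
        fromBlocks (lam • (1 : Matrix (Fin n) (Fin n) ℝ) - A) T Hᵀ
        (lam • (1 : Matrix (Fin m) (Fin m) ℝ) - Hᵀ * T) - U * S * Uᵀ := by
      have hP : U * S * Uᵀ = fromBlocks 0 Jnm Jmn 0 := by
        ext x y
        rcases x with i | e <;> rcases y with j | f <;>
          simp [Matrix.mul_apply, U, S, hJnm, hJmn]
      rw [hP]
      generalize Hᵀ * T = L
      ext x y
      rcases x with i | e <;> rcases y with j | f <;>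
        simp [Matrix.one_apply]
    have hUU : Uᵀ * U = !![(n : ℝ), 0; 0, (m : ℝ)] := by
      ext i j
      fin_cases i <;> fin_cases j <;> simp [Matrix.mul_apply, U]
    have hmr : (m : ℝ) = n * r := by rw [hm]; push_cast; rfl
    have hp := aux_pert _ U G S (by rw [hGd]; exact hφ) hKU
    have hK := aux_det_K0 n m hnm T H lam
    rw [← hA] at hK
    rw [← hM, hK, hGd, hUU] at hp
    rw [hp]
    have hd : (G - S * !![(n : ℝ), 0; 0, (m : ℝ)]).det = lam ^ 2 - (r : ℝ) * (2 * lam + 1)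
        + (r : ℝ) ^ 2 + 2 * (m : ℝ) - (m : ℝ) * (n : ℝ) := by
      simp [G, S, Matrix.det_fin_two]
      linear_combination (-1 : ℝ) * hmr
    rw [hd]; ring
end

section
/- Spectrum of D^{−−0}: Let D be a simple r-regular digraph with n ≥ 1 vertices and m = n·r arcs (r ≥ 1), encoded by incidence matrices T, H : Matrix (Fin n) (Fin m) ℝ, and let A = T * Hᵀ. Let M = fromBlocks (J_{n,n} − I_n − A) 0 0 (J_{m,m} − I_m − Hᵀ * T) (the adjacency matrix of the transformation D^{−−0}, the disjoint union of the complement of D and the complement of the line digraph D^l, with no arcs between the two parts). Then for every λ ∈ ℝ: (λ + r + 1)² · det(λ·I_{n+m} − M) = (λ + 1)^{m−n} · (λ − n + r + 1) · (λ − m + r + 1) · det((−λ − 1)·I_n − A)². -/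
open Matrix

theorem aux_det_sub_J {k : ℕ} (B J : Matrix (Fin k) (Fin k) ℝ) (hJ : ∀ i j, J i j = 1) (s : ℝ)
    (hB : ∀ i, ∑ j, B i j = s) : s * (B - J).det = (s - k) * B.det := by
  by_cases hs : s = 0
  · subst hs
    rcases Nat.eq_zero_or_pos k with hk | hk
    · subst hk; simp
    · have : B.det = 0 := by
        apply Matrix.exists_mulVec_eq_zero_iff.1
        refine ⟨fun _ => 1, ?_, ?_⟩
        · intro h
          have := congrFun h ⟨0, hk⟩
          simp at this
        · funext i
          simp [Matrix.mulVec, dotProduct, hB]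
      rw [this]; simp
  · have h1 : B - J = B * (1 + replicateCol Unit (fun _ : Fin k => -s⁻¹) * replicateRow Unit (fun _ : Fin k => (1:ℝ))) := by
      rw [mul_add, mul_one, sub_eq_add_neg]
      congr 1
      ext i j
      simp [Matrix.mul_apply, hJ, ← Finset.sum_mul, hB, hs]
    rw [h1, det_mul, det_one_add_replicateCol_mul_replicateRow]
    simp [dotProduct]
    field_simp
    ring

theorem aux_det_comm {n m : ℕ} (hnm : n ≤ m) (T H : Matrix (Fin n) (Fin m) ℝ) (x : ℝ) :
    (x • (1 : Matrix (Fin m) (Fin m) ℝ) + Hᵀ * T).det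
      = x ^ (m - n) * (x • (1 : Matrix (Fin n) (Fin n) ℝ) + T * Hᵀ).det := by
  have h := Matrix.charpoly_mul_comm' (-Hᵀ) T
  have h2 : (-Hᵀ * T).charpoly = Polynomial.X ^ (m - n) * (T * -Hᵀ).charpoly := by
    have hX : (Polynomial.X : Polynomial ℝ) ^ n ≠ 0 := pow_ne_zero _ Polynomial.X_ne_zero
    apply mul_left_cancel₀ hX
    rw [← mul_assoc, ← pow_add, Nat.add_sub_cancel' hnm]
    simpa using h
  have h3 := congrArg (Polynomial.eval x) h2
  rw [Polynomial.eval_mul, Polynomial.eval_pow, Polynomial.eval_X, Matrix.eval_charpoly, Matrix.eval_charpoly] at h3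
  simpa [Matrix.smul_one_eq_diagonal, Matrix.scalar_apply] using h3

/-- Spectrum of the transformation `D^{--0}` of a simple `r`-regular digraph. -/
theorem spectrum_minus_minus_zero (n r m : ℕ) (hn : 1 ≤ n) (hr : 1 ≤ r) (hm : m = n * r)
    (T H : Matrix (Fin n) (Fin m) ℝ)
    (hT01 : ∀ i e, T i e = 0 ∨ T i e = 1)
    (hH01 : ∀ i e, H i e = 0 ∨ H i e = 1)
    (hTcol : ∀ e, ∑ i, T i e = 1)
    (hHcol : ∀ e, ∑ i, H i e = 1)
    (hnoloop : ∀ e, ∑ v, T v e * H v e = 0)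
    (hA01 : ∀ i j, (T * Hᵀ) i j = 0 ∨ (T * Hᵀ) i j = 1)
    (hTrow : ∀ i, ∑ e, T i e = (r : ℝ))
    (hHrow : ∀ i, ∑ e, H i e = (r : ℝ))
    (Jnn : Matrix (Fin n) (Fin n) ℝ) (hJnn : ∀ i j, Jnn i j = 1)
    (Jmm : Matrix (Fin m) (Fin m) ℝ) (hJmm : ∀ e f, Jmm e f = 1)
    (A : Matrix (Fin n) (Fin n) ℝ) (hA : A = T * Hᵀ)
    (lam : ℝ) :
    (lam + (r : ℝ) + 1) ^ 2 *
        (lam • (1 : Matrix (Fin n ⊕ Fin m) (Fin n ⊕ Fin m) ℝ)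
          - Matrix.fromBlocks (Jnn - 1 - A) 0 0 (Jmm - 1 - Hᵀ * T)).det
      = (lam + 1) ^ (m - n) * (lam - (n : ℝ) + (r : ℝ) + 1) *
          (lam - (m : ℝ) + (r : ℝ) + 1) *
        ((-lam - 1) • (1 : Matrix (Fin n) (Fin n) ℝ) - A).det ^ 2 := by
  have hnm : n ≤ m := by rw [hm]; exact Nat.le_mul_of_pos_right n hr
  have hArow : ∀ i, ∑ j, (T * Hᵀ) i j = (r : ℝ) := by
    intro i
    simp only [Matrix.mul_apply, Matrix.transpose_apply]
    rw [Finset.sum_comm]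
    simp [← Finset.mul_sum, hHcol, hTrow]
  have hLrow : ∀ e, ∑ f, (Hᵀ * T) e f = (r : ℝ) := by
    intro e
    simp only [Matrix.mul_apply, Matrix.transpose_apply]
    rw [Finset.sum_comm]
    simp [← Finset.mul_sum, hTrow, ← Finset.sum_mul, hHcol]
  have e1 := aux_det_sub_J ((lam + 1) • (1 : Matrix (Fin n) (Fin n) ℝ) + T * Hᵀ) Jnn hJnn
    (lam + 1 + r) (by
      intro i
      simp only [Matrix.add_apply, Finset.sum_add_distrib, hArow]
      simp [Matrix.one_apply])
  have e2 := aux_det_sub_J ((lam + 1) • (1 : Matrix (Fin m) (Fin m) ℝ) + Hᵀ * T) Jmm hJmm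
    (lam + 1 + r) (by
      intro i
      simp only [Matrix.add_apply, Finset.sum_add_distrib, hLrow]
      simp [Matrix.one_apply])
  rw [aux_det_comm hnm] at e2
  have e3 : ((-lam - 1) • (1 : Matrix (Fin n) (Fin n) ℝ) - A).det ^ 2
      = ((lam + 1) • (1 : Matrix (Fin n) (Fin n) ℝ) + T * Hᵀ).det ^ 2 := by
    have : (-lam - 1) • (1 : Matrix (Fin n) (Fin n) ℝ) - A
        = -((lam + 1) • (1 : Matrix (Fin n) (Fin n) ℝ) + T * Hᵀ) := by
      rw [hA]; module
    rw [this, Matrix.det_neg, mul_pow, ← pow_mul, mul_comm _ 2, pow_mul]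
    simp
  have e4 : lam • (1 : Matrix (Fin n ⊕ Fin m) (Fin n ⊕ Fin m) ℝ)
          - Matrix.fromBlocks (Jnn - 1 - A) 0 0 (Jmm - 1 - Hᵀ * T)
      = Matrix.fromBlocks ((lam + 1) • (1 : Matrix (Fin n) (Fin n) ℝ) + T * Hᵀ - Jnn) 0 0
          ((lam + 1) • (1 : Matrix (Fin m) (Fin m) ℝ) + Hᵀ * T - Jmm) := by
    rw [← Matrix.fromBlocks_one, Matrix.fromBlocks_smul, sub_eq_add_neg, Matrix.fromBlocks_neg,
      Matrix.fromBlocks_add, hA]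
    congr 1
    · module
    · simp
    · simp
    · module
  rw [e3, e4, Matrix.det_fromBlocks_zero₂₁]
  generalize ((lam + 1) • (1 : Matrix (Fin n) (Fin n) ℝ) + T * Hᵀ - Jnn).det = a at *
  generalize ((lam + 1) • (1 : Matrix (Fin m) (Fin m) ℝ) + Hᵀ * T - Jmm).det = b at *
  generalize ((lam + 1) • (1 : Matrix (Fin n) (Fin n) ℝ) + T * Hᵀ).det = d at *
  calc _ = ((lam + 1 + r) * a) * ((lam + 1 + r) * b) := by ring
    _ = _ := by rw [e1, e2]; ring
end

section
/- Cospectrality of F^{+−+} and F^{−++} for a simple digraph-function: Let f : Fin n → Fin n satisfy f x ≠ x for all x (so the digraph-function F = D_f is a simple digraph), and let A = A_f. Order the arcs of F so that arc i is (i, f i); then the transformations F^{+−+} and F^{−++} have adjacency matrices M₁ = fromBlocks A I_n A (J − I_n − A) and M₂ = fromBlocks (J − I_n − A) I_n A A, respectively. Then for every λ ∈ ℝ: det(λ·I_{2n} − M₁) = det(λ·I_{2n} − M₂), i.e. F^{+−+} and F^{−++} are cospectral. -/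
open Matrix

theorem aux_block {n : ℕ} (P R S : Matrix (Fin n) (Fin n) ℝ) :
    (fromBlocks P (-1) R S).det
      = (fromBlocks (0 : Matrix (Fin n) (Fin n) ℝ) (-1) 1 (0 : Matrix (Fin n) (Fin n) ℝ)).det
        * (S * P + R).det := by
  have h : fromBlocks 1 0 S 1 * fromBlocks P (-1) R S * fromBlocks 1 0 P 1
      = fromBlocks (0 : Matrix (Fin n) (Fin n) ℝ) (-1) 1 (0 : Matrix (Fin n) (Fin n) ℝ)
        * fromBlocks (S * P + R) 0 0 1 := by
    simp [fromBlocks_multiply]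
  have h2 := congrArg det h
  simpa [det_mul, det_fromBlocks_zero₁₂] using h2

theorem aux_rank {n : ℕ} (X J V : Matrix (Fin n) (Fin n) ℝ) (hJ : ∀ i j, J i j = 1) (c : ℝ)
    (hc : c ≠ 0) (hX : X * J = c • J) (d : ℝ) (hV : V * J = d • J) :
    (X + J * V).det = X.det * (1 + c⁻¹ * (n * d)) := by
  have h1 : X + J * V = X * (1 + (c⁻¹ • J) * V) := by
    rw [mul_add, mul_one, ← mul_assoc, mul_smul_comm, hX, smul_smul, inv_mul_cancel₀ hc, one_smul]
  have hJ2 : c⁻¹ • J = replicateCol Unit (fun _ : Fin n => c⁻¹) *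
      replicateRow Unit (fun _ : Fin n => (1 : ℝ)) := by
    ext i j
    simp [Matrix.mul_apply, hJ]
  rw [h1, det_mul, hJ2, Matrix.mul_assoc, det_one_add_mul_comm]
  congr 1
  rw [det_unique]
  have hs : ∀ i, ∑ j, V i j = d := by
    intro i
    have := congrFun (congrFun hV i) i
    simpa [Matrix.mul_apply, hJ] using this
  simp only [Matrix.add_apply, Matrix.one_apply_eq, Matrix.mul_apply, replicateCol_apply,
    replicateRow_apply, one_mul, ← Finset.sum_mul]
  rw [Finset.sum_comm]
  simp [hs, mul_comm]

/-- Cospectrality of `F^{+-+}` and `F^{-++}` for a simple digraph-function `F = D_f`. -/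
theorem cospectral_plus_minus_plus (n : ℕ) (f : Fin n → Fin n)
    (hf : ∀ x, f x ≠ x)
    (A J : Matrix (Fin n) (Fin n) ℝ)
    (hA : ∀ i j, A i j = if j = f i then 1 else 0)
    (hJ : ∀ i j, J i j = 1)
    (lam : ℝ) :
    (lam • (1 : Matrix (Fin n ⊕ Fin n) (Fin n ⊕ Fin n) ℝ)
        - Matrix.fromBlocks A 1 A (J - 1 - A)).det
      = (lam • (1 : Matrix (Fin n ⊕ Fin n) (Fin n ⊕ Fin n) ℝ)
        - Matrix.fromBlocks (J - 1 - A) 1 A A).det := by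
  have hAJ : A * J = J := by
    ext i j
    simp [Matrix.mul_apply, hA, hJ]
  have key : ∀ l : ℝ, l ^ 2 + l - 3 ≠ 0 →
      (l • (1 : Matrix (Fin n ⊕ Fin n) (Fin n ⊕ Fin n) ℝ)
        - Matrix.fromBlocks A 1 A (J - 1 - A)).det
      = (l • (1 : Matrix (Fin n ⊕ Fin n) (Fin n ⊕ Fin n) ℝ)
        - Matrix.fromBlocks (J - 1 - A) 1 A A).det := by
    intro l hl
    have e : ∀ P R S : Matrix (Fin n) (Fin n) ℝ,
        l • (1 : Matrix (Fin n ⊕ Fin n) (Fin n ⊕ Fin n) ℝ) - fromBlocks P 1 R S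
          = fromBlocks (l • 1 - P) (-1) (-R) (l • 1 - S) := by
      intro P R S
      rw [← fromBlocks_one, fromBlocks_smul, sub_eq_add_neg, fromBlocks_neg, fromBlocks_add]
      simp [sub_eq_add_neg]
    rw [e, e, aux_block (l • 1 - A), aux_block (l • 1 - (J - 1 - A))]
    congr 1
    set X : Matrix (Fin n) (Fin n) ℝ := (l ^ 2 + l) • 1 - (2 : ℝ) • A - A * A with hXd
    have hX : X * J = (l ^ 2 + l - 3) • J := by
      simp only [hXd, sub_mul, smul_mul_assoc, one_mul, mul_assoc, hAJ]
      module
    have h1 : (l • 1 - (J - 1 - A)) * (l • 1 - A) + -A = X + J * (A - l • 1) := by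
      simp only [hXd, sub_mul, mul_sub, smul_mul_assoc, mul_smul_comm, one_mul, mul_one]
      module
    have h2 : (l • 1 - A) * (l • 1 - (J - 1 - A)) + -A = X + J * ((1 - l) • 1) := by
      simp only [hXd, sub_mul, mul_sub, smul_mul_assoc, mul_smul_comm, one_mul, mul_one, hAJ]
      module
    rw [h1, h2, aux_rank X J _ hJ _ hl hX (1 - l), aux_rank X J _ hJ _ hl hX (1 - l)]
    · simp
    · simp only [sub_mul, smul_mul_assoc, one_mul, hAJ]
      module
  have hd : Dense {l : ℝ | l ^ 2 + l - 3 ≠ 0} := by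
    have hfin : Set.Finite {l : ℝ | l ^ 2 + l - 3 = 0} := by
      refine Set.Finite.subset
        (Set.toFinite {(-1 + √13) / 2, (-1 - √13) / 2}) ?_
      intro l hl
      have h13 : √(13 : ℝ) ^ 2 = 13 := Real.sq_sqrt (by norm_num)
      have hl' : l ^ 2 + l - 3 = 0 := hl
      have : (l - (-1 + √13) / 2) * (l - (-1 - √13) / 2) = 0 := by
        linear_combination hl' - h13 / 4
      rcases mul_eq_zero.mp this with h | h
      · left; linarith
      · right; simp only [Set.mem_singleton_iff]; linarith
    exact hfin.countable.dense_compl ℝ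
  have := Continuous.ext_on hd
    (f := fun l : ℝ => (l • (1 : Matrix (Fin n ⊕ Fin n) (Fin n ⊕ Fin n) ℝ)
        - Matrix.fromBlocks A 1 A (J - 1 - A)).det)
    (g := fun l : ℝ => (l • (1 : Matrix (Fin n ⊕ Fin n) (Fin n ⊕ Fin n) ℝ)
        - Matrix.fromBlocks (J - 1 - A) 1 A A).det)
    (Continuous.matrix_det (by fun_prop)) (Continuous.matrix_det (by fun_prop))
    (fun l hl => key l hl)
  exact congrFun this lam
end
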